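/- Let H be a Hopf algebra, H_par its universal partial Hopf algebra, and A ⊆ H_par the subalgebra generated by the elements ε_h = [h₍₁₎][S(h₍₂₎)]. Then the formula h·a = [h₍₁₎]a[S(h₍₂₎)] defines a symmetric partial action of H on A; in particular h·(ε_{k¹}⋯ε_{kⁿ}) = ε_{h₍₁₎k¹}⋯ε_{h₍ₙ₎kⁿ}ε_{h₍ₙ₊₁₎} lies in A, 1_H·a = a, h·(ab) = (h₍₁₎·a)(h₍₂₎·b), and h·(k·a) = (h₍₁₎·1)(h₍₂₎k·a) = (h₍₁₎k·a)(h₍₂₎·1). -/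

import Mathlib

open TensorProduct BigOperators HopfAlgebra

variable (k : Type) [CommRing k] (H : Type) [Ring H] [HopfAlgebra k H]

/-- `sw f g : H → T(H)` is the Sweedler convolution `x ↦ ∑ f(x₍₁₎) * g(x₍₂₎)`. -/
noncomputable def sw (f g : H →ₗ[k] TensorAlgebra k H) : H →ₗ[k] TensorAlgebra k H :=
  (LinearMap.mul' k (TensorAlgebra k H)) ∘ₗ (TensorProduct.map f g) ∘ₗ
    (Coalgebra.comul (R := k))

/-- The defining relations of the universal partial "Hopf" algebra `H_par`,
imposed on the tensor algebra `T(H)`. -/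
inductive HparRel : TensorAlgebra k H → TensorAlgebra k H → Prop
  | one : HparRel (TensorAlgebra.ι k (1 : H)) 1
  | pr2 (h x : H) : HparRel
      (TensorAlgebra.ι k h *
        sw k H (TensorAlgebra.ι k) ((TensorAlgebra.ι k) ∘ₗ antipode (R := k)) x)
      (sw k H ((TensorAlgebra.ι k) ∘ₗ LinearMap.mulLeft k h)
        ((TensorAlgebra.ι k) ∘ₗ antipode (R := k)) x)
  | pr3 (h x : H) : HparRel
      (sw k H (TensorAlgebra.ι k) ((TensorAlgebra.ι k) ∘ₗ antipode (R := k)) h *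
        TensorAlgebra.ι k x)
      (sw k H (TensorAlgebra.ι k)
        ((TensorAlgebra.ι k) ∘ₗ (LinearMap.mulRight k x) ∘ₗ antipode (R := k)) h)
  | pr4 (h x : H) : HparRel
      (TensorAlgebra.ι k h *
        sw k H ((TensorAlgebra.ι k) ∘ₗ antipode (R := k)) (TensorAlgebra.ι k) x)
      (sw k H ((TensorAlgebra.ι k) ∘ₗ (LinearMap.mulLeft k h) ∘ₗ antipode (R := k))
        (TensorAlgebra.ι k) x)
  | pr5 (h x : H) : HparRel
      (sw k H ((TensorAlgebra.ι k) ∘ₗ antipode (R := k)) (TensorAlgebra.ι k) h *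
        TensorAlgebra.ι k x)
      (sw k H ((TensorAlgebra.ι k) ∘ₗ antipode (R := k))
        ((TensorAlgebra.ι k) ∘ₗ LinearMap.mulRight k x) h)

/-- The universal partial "Hopf" algebra `H_par` of a Hopf algebra `H`. -/
abbrev Hpar : Type := RingQuot (HparRel k H)

/-- The canonical (universal) partial representation `h ↦ [h]` of `H` on `H_par`. -/
noncomputable def bracket : H →ₗ[k] Hpar k H :=
  (RingQuot.mkAlgHom k (HparRel k H)).toLinearMap ∘ₗ TensorAlgebra.ι k

/-- `ε_h = [h₍₁₎][S(h₍₂₎)]` in `H_par`. -/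
noncomputable def epsilonPar : H →ₗ[k] Hpar k H :=
  (LinearMap.mul' k (Hpar k H)) ∘ₗ
    (TensorProduct.map (bracket k H) ((bracket k H) ∘ₗ antipode (R := k))) ∘ₗ
    (Coalgebra.comul (R := k))

/-- `h · a = [h₍₁₎] a [S(h₍₂₎)]` in `H_par`. -/
noncomputable def hact (h : H) (a : Hpar k H) : Hpar k H :=
  (LinearMap.mul' k (Hpar k H))
    ((TensorProduct.map (bracket k H)
      ((LinearMap.mulLeft k a) ∘ₗ (bracket k H) ∘ₗ antipode (R := k)))
      (Coalgebra.comul (R := k) h))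

section Aux
open WithConv Coalgebra

variable {k H}
variable {C D B : Type} [AddCommMonoid C] [Module k C] [Coalgebra k C]
  [AddCommMonoid D] [Module k D] [Coalgebra k D] [Ring B] [Algebra k B]

/-- A partial representation. -/
structure PRep (β : H →ₗ[k] B) : Prop where
  one : β 1 = 1
  p2 : ∀ h x, β h * (toConv β * toConv (β ∘ₗ antipode k)) x =
    (toConv (β ∘ₗ LinearMap.mulLeft k h) * toConv (β ∘ₗ antipode k)) x
  p3 : ∀ h x, (toConv β * toConv (β ∘ₗ antipode k)) h * β x =
    (toConv β * toConv (β ∘ₗ LinearMap.mulRight k x ∘ₗ antipode k)) h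
  p4 : ∀ h x, β h * (toConv (β ∘ₗ antipode k) * toConv β) x =
    (toConv (β ∘ₗ LinearMap.mulLeft k h ∘ₗ antipode k) * toConv β) x
  p5 : ∀ h x, (toConv (β ∘ₗ antipode k) * toConv β) h * β x =
    (toConv (β ∘ₗ antipode k) * toConv (β ∘ₗ LinearMap.mulRight k x)) h

noncomputable def bb (β : H →ₗ[k] B) (f : WithConv (C →ₗ[k] H)) : WithConv (C →ₗ[k] B) :=
  toConv (β ∘ₗ f.ofConv)

noncomputable def cst (a : B) : WithConv (C →ₗ[k] B) :=
  toConv (LinearMap.toSpanSingleton k B a ∘ₗ counit)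

noncomputable def pull {M : Type} [AddCommMonoid M] [Module k M]
    (f : WithConv (C →ₗ[k] M)) (g : D →ₗc[k] C) : WithConv (D →ₗ[k] M) :=
  toConv (f.ofConv ∘ₗ g.toLinearMap)

noncomputable def cg (g : C →ₗc[k] H) : WithConv (C →ₗ[k] H) := toConv g.toLinearMap
noncomputable def sg (g : C →ₗc[k] H) : WithConv (C →ₗ[k] H) :=
  toConv (antipode k ∘ₗ g.toLinearMap)

lemma pull_mul (f f' : WithConv (C →ₗ[k] B)) (g : D →ₗc[k] C) :
    pull (f * f') g = pull f g * pull f' g := by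
  apply WithConv.ext
  exact LinearMap.convMul_comp_coalgHom_distrib f f' g

lemma pull_cst (a : B) (g : D →ₗc[k] C) : pull (cst (k := k) a) g = cst a := by
  ext c; simp [pull, cst]

lemma cst_mul_apply (a : B) (f : WithConv (C →ₗ[k] B)) (c : C) : (cst a * f).ofConv c = a * f c := by
  rw [(ℛ k c).convMul_apply]
  conv_rhs => rw [← sum_counit_smul (ℛ k c)]
  simp [cst, Finset.mul_sum]

lemma sum_smul_counit' {c : C} {ι : Type} (R : Repr k c ι) :
    ∑ x ∈ R.index, counit (R := k) (R.right x) • R.left x = c := by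
  have := congr(TensorProduct.rid k C $(sum_tmul_counit_eq (R := k) R))
  simpa only [map_sum, TensorProduct.rid_tmul, one_smul] using this

lemma mul_cst_apply (a : B) (f : WithConv (C →ₗ[k] B)) (c : C) : (f * cst a).ofConv c = f c * a := by
  rw [(ℛ k c).convMul_apply]
  conv_rhs => rw [← sum_smul_counit' (ℛ k c)]
  simp [cst, Finset.sum_mul]

lemma cst_mul (a b : B) : (cst (a * b) : WithConv (C →ₗ[k] B)) = cst a * cst b := by
  ext c
  rw [cst_mul_apply]; simp [cst]

lemma cst_one : (cst (1 : B) : WithConv (C →ₗ[k] B)) = 1 := by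
  ext c
  simp [cst, Algebra.algebraMap_eq_smul_one]

lemma cg_mul_sg (g : C →ₗc[k] H) : cg g * sg g = 1 := by
  have := LinearMap.convMul_comp_coalgHom_distrib (toConv (LinearMap.id (R := k) (M := H)))
    (toConv (antipode k)) g
  rw [LinearMap.id_mul_antipode] at this
  apply WithConv.ext
  refine this.symm.trans ?_
  ext c; simp

lemma sg_mul_cg (g : C →ₗc[k] H) : sg g * cg g = 1 := by
  have := LinearMap.convMul_comp_coalgHom_distrib (toConv (antipode k))
    (toConv (LinearMap.id (R := k) (M := H))) g
  rw [LinearMap.antipode_mul_id] at this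
  apply WithConv.ext
  refine this.symm.trans ?_
  ext c; simp

/-- left absorption -/
lemma left_abs {β : H →ₗ[k] B} (v w : H →ₗ[k] H)
    (hyp : ∀ h x, β h * (toConv (β ∘ₗ v) * toConv (β ∘ₗ w)) x =
      (toConv (β ∘ₗ LinearMap.mulLeft k h ∘ₗ v) * toConv (β ∘ₗ w)) x)
    (f : WithConv (C →ₗ[k] H)) (g : C →ₗc[k] H) :
    bb β f * (bb β (toConv (v ∘ₗ g.toLinearMap)) * bb β (toConv (w ∘ₗ g.toLinearMap))) =
      bb β (f * toConv (v ∘ₗ g.toLinearMap)) * bb β (toConv (w ∘ₗ g.toLinearMap)) := by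
  ext c
  have e : bb β (toConv (v ∘ₗ g.toLinearMap)) * bb β (toConv (w ∘ₗ g.toLinearMap)) =
      pull (toConv (β ∘ₗ v) * toConv (β ∘ₗ w)) g := by
    rw [pull_mul]; rfl
  rw [e, (ℛ k c).convMul_apply, (ℛ k c).convMul_apply]
  have key := congr(LinearMap.mul' k B (TensorProduct.map
    (β ∘ₗ LinearMap.mul' k H ∘ₗ TensorProduct.map f.ofConv (v ∘ₗ g.toLinearMap))
    (β ∘ₗ w ∘ₗ g.toLinearMap) ((TensorProduct.assoc k C C C).symm
    $(sum_tmul_tmul_eq (ℛ k c) (fun i => ℛ k _) (fun i => ℛ k _)))))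
  simp only [map_sum, TensorProduct.assoc_symm_tmul, TensorProduct.map_tmul, LinearMap.comp_apply,
    LinearMap.mul'_apply] at key
  refine Eq.trans ?_ (key.symm.trans ?_)
  · refine Finset.sum_congr rfl fun i _ => ?_
    refine (hyp (f ((ℛ k c).left i)) (g ((ℛ k c).right i))).trans ?_
    rw [((ℛ k ((ℛ k c).right i)).induced g).convMul_apply]
    rfl
  · refine Finset.sum_congr rfl fun i _ => ?_
    simp only [bb, LinearMap.comp_apply]
    rw [(ℛ k ((ℛ k c).left i)).convMul_apply, map_sum, Finset.sum_mul]
    rfl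

lemma right_abs {β : H →ₗ[k] B} (v w : H →ₗ[k] H)
    (hyp : ∀ h x, (toConv (β ∘ₗ v) * toConv (β ∘ₗ w)) h * β x =
      (toConv (β ∘ₗ v) * toConv (β ∘ₗ LinearMap.mulRight k x ∘ₗ w)) h)
    (f : WithConv (C →ₗ[k] H)) (g : C →ₗc[k] H) :
    bb β (toConv (v ∘ₗ g.toLinearMap)) * bb β (toConv (w ∘ₗ g.toLinearMap)) * bb β f =
      bb β (toConv (v ∘ₗ g.toLinearMap)) * bb β (toConv (w ∘ₗ g.toLinearMap) * f) := by
  ext c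
  have e : bb β (toConv (v ∘ₗ g.toLinearMap)) * bb β (toConv (w ∘ₗ g.toLinearMap)) =
      pull (toConv (β ∘ₗ v) * toConv (β ∘ₗ w)) g := by
    rw [pull_mul]; rfl
  rw [e, (ℛ k c).convMul_apply, (ℛ k c).convMul_apply]
  have key := congr(LinearMap.mul' k B (TensorProduct.map
    (β ∘ₗ v ∘ₗ g.toLinearMap)
    (β ∘ₗ LinearMap.mul' k H ∘ₗ TensorProduct.map (w ∘ₗ g.toLinearMap) f.ofConv)
    $(sum_tmul_tmul_eq (ℛ k c) (fun i => ℛ k _) (fun i => ℛ k _))))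
  simp only [map_sum, TensorProduct.map_tmul, LinearMap.comp_apply,
    LinearMap.mul'_apply] at key
  refine Eq.trans ?_ (key.trans ?_)
  · refine Finset.sum_congr rfl fun i _ => ?_
    refine (hyp (g ((ℛ k c).left i)) (f ((ℛ k c).right i))).trans ?_
    rw [((ℛ k ((ℛ k c).left i)).induced g).convMul_apply]
    rfl
  · refine Finset.sum_congr rfl fun i _ => ?_
    simp only [bb, LinearMap.comp_apply]
    rw [(ℛ k ((ℛ k c).right i)).convMul_apply, map_sum, Finset.mul_sum]
    rfl

variable {β : H →ₗ[k] B}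

lemma P1 (hβ : PRep β) : bb β (1 : WithConv (C →ₗ[k] H)) = 1 := by
  ext c
  simp [bb, Algebra.algebraMap_eq_smul_one, hβ.one]

lemma P2 (hβ : PRep β) (f : WithConv (C →ₗ[k] H)) (g : C →ₗc[k] H) :
    bb β f * (bb β (cg g) * bb β (sg g)) = bb β (f * cg g) * bb β (sg g) :=
  left_abs LinearMap.id (antipode k) hβ.p2 f g
lemma P3 (hβ : PRep β) (f : WithConv (C →ₗ[k] H)) (g : C →ₗc[k] H) :
    bb β (cg g) * bb β (sg g) * bb β f = bb β (cg g) * bb β (sg g * f) :=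
  right_abs LinearMap.id (antipode k) hβ.p3 f g
lemma P4 (hβ : PRep β) (f : WithConv (C →ₗ[k] H)) (g : C →ₗc[k] H) :
    bb β f * (bb β (sg g) * bb β (cg g)) = bb β (f * sg g) * bb β (cg g) :=
  left_abs (antipode k) LinearMap.id hβ.p4 f g
lemma P5 (hβ : PRep β) (f : WithConv (C →ₗ[k] H)) (g : C →ₗc[k] H) :
    bb β (sg g) * bb β (cg g) * bb β f = bb β (sg g) * bb β (cg g * f) :=
  right_abs (antipode k) LinearMap.id hβ.p5 f g

noncomputable def EE (β : H →ₗ[k] B) (g : C →ₗc[k] H) : WithConv (C →ₗ[k] B) :=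
  bb β (cg g) * bb β (sg g)

noncomputable def ET (β : H →ₗ[k] B) (g : C →ₗc[k] H) : WithConv (C →ₗ[k] B) :=
  bb β (sg g) * bb β (cg g)

noncomputable def Ph (β : H →ₗ[k] B) (g : C →ₗc[k] H) (a : B) : WithConv (C →ₗ[k] B) :=
  bb β (cg g) * cst a * bb β (sg g)

lemma csc (hβ : PRep β) (g : C →ₗc[k] H) : bb β (cg g) * ET β g = bb β (cg g) := by
  rw [ET, P4 hβ, cg_mul_sg, P1 hβ, one_mul]

lemma scs (hβ : PRep β) (g : C →ₗc[k] H) : ET β g * bb β (sg g) = bb β (sg g) := by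
  rw [ET, P5 hβ, cg_mul_sg, P1 hβ, mul_one]

lemma sg_mul {g g' m : C →ₗc[k] H} (hm : cg m = cg g * cg g') : sg m = sg g' * sg g := by
  refine left_inv_eq_right_inv (sg_mul_cg m) ?_
  rw [hm, mul_assoc, ← mul_assoc (cg g'), cg_mul_sg, one_mul, cg_mul_sg]

lemma EE_ET (hβ : PRep β) {g g' m : C →ₗc[k] H} (hm : cg m = cg g * cg g') :
    EE β g' * ET β g = ET β g * EE β g' := by
  have hs := sg_mul hm
  have h1 : cg m * sg g' = cg g := by rw [hm, mul_assoc, cg_mul_sg, mul_one]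
  have h2 : cg g' * sg m = sg g := by rw [hs, ← mul_assoc, cg_mul_sg, one_mul]
  calc EE β g' * ET β g = (bb β (cg g') * bb β (sg g') * bb β (sg g)) * bb β (cg g) := by
        simp only [EE, ET, mul_assoc]
    _ = bb β (cg g') * (bb β (sg m) * bb β (cg m * sg g')) := by
        rw [P3 hβ, ← hs, h1, mul_assoc]
    _ = (bb β (cg g') * (bb β (sg m) * bb β (cg m))) * bb β (sg g') := by
        rw [← P5 hβ]; simp only [mul_assoc]
    _ = bb β (sg g) * (bb β (cg g * cg g') * bb β (sg g')) := by
        rw [P4 hβ, h2, hm, mul_assoc]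
    _ = _ := by rw [← P2 hβ]; simp only [EE, ET, mul_assoc]

lemma push (hβ : PRep β) {g g' m : C →ₗc[k] H} (hm : cg m = cg g * cg g') :
    bb β (cg g) * EE β g' = EE β m * bb β (cg g) := by
  symm
  calc EE β m * bb β (cg g) = bb β (cg m) * (bb β (sg g' * sg g) * bb β (cg g)) := by
        rw [EE, sg_mul hm, mul_assoc]
    _ = (bb β (cg g * cg g') * bb β (sg g')) * ET β g := by
        rw [← P4 hβ, hm, ET]; simp only [mul_assoc]
    _ = bb β (cg g) * (EE β g' * ET β g) := by
        rw [← P2 hβ, EE, mul_assoc]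
    _ = _ := by rw [EE_ET hβ hm, ← mul_assoc, csc hβ]

lemma pull_bb_cg (g : C →ₗc[k] H) (p : D →ₗc[k] C) :
    pull (bb β (cg g)) p = bb β (cg (g.comp p)) := rfl
lemma pull_bb_sg (g : C →ₗc[k] H) (p : D →ₗc[k] C) :
    pull (bb β (sg g)) p = bb β (sg (g.comp p)) := rfl
lemma pull_EE (g : C →ₗc[k] H) (p : D →ₗc[k] C) : pull (EE β g) p = EE β (g.comp p) := by
  rw [EE, pull_mul, pull_bb_cg, pull_bb_sg, EE]
lemma pull_ET (g : C →ₗc[k] H) (p : D →ₗc[k] C) : pull (ET β g) p = ET β (g.comp p) := by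
  rw [ET, pull_mul, pull_bb_cg, pull_bb_sg, ET]
lemma pull_Ph (g : C →ₗc[k] H) (p : D →ₗc[k] C) (a : B) :
    pull (Ph β g a) p = Ph β (g.comp p) a := by
  rw [Ph, pull_mul, pull_mul, pull_bb_cg, pull_bb_sg, pull_cst, Ph]

noncomputable def pX : H ⊗[k] H →ₗc[k] H :=
  (Coalgebra.TensorProduct.rid k k H : H ⊗[k] k →ₗc[k] H).comp
    (Coalgebra.TensorProduct.map (CoalgHom.id k H) (counitCoalgHom k H))
noncomputable def pY : H ⊗[k] H →ₗc[k] H :=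
  (Coalgebra.TensorProduct.lid k H : k ⊗[k] H →ₗc[k] H).comp
    (Coalgebra.TensorProduct.map (counitCoalgHom k H) (CoalgHom.id k H))
noncomputable def pM : H ⊗[k] H →ₗc[k] H := Bialgebra.mulCoalgHom k H

@[simp] lemma pX_tmul (h x : H) : pX (k := k) (h ⊗ₜ x) = counit (R := k) x • h := rfl
@[simp] lemma pY_tmul (h x : H) : pY (k := k) (h ⊗ₜ x) = counit (R := k) h • x := rfl
@[simp] lemma pM_tmul (h x : H) : pM (k := k) (h ⊗ₜ x) = h * x := rfl

noncomputable def res (x : H) (F : WithConv (H ⊗[k] H →ₗ[k] B)) : WithConv (H →ₗ[k] B) :=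
  toConv (F.ofConv ∘ₗ (TensorProduct.mk k H H).flip x)

lemma res_apply (x h : H) (F : WithConv (H ⊗[k] H →ₗ[k] B)) : res x F h = F (h ⊗ₜ x) := rfl

lemma res_left (x : H) (f : WithConv (H →ₗ[k] B)) (G : WithConv (H ⊗[k] H →ₗ[k] B)) :
    res x (pull f pX * G) = f * res x G := by
  ext h
  rw [res_apply, ((ℛ k h).tmul (ℛ k x)).convMul_apply, (ℛ k h).convMul_apply]
  conv_rhs => rw [← sum_counit_smul (ℛ k x)]
  simp [pull, res_apply, Finset.sum_product, Finset.mul_sum, TensorProduct.tmul_sum]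

lemma res_right (x : H) (f : WithConv (H →ₗ[k] B)) (G : WithConv (H ⊗[k] H →ₗ[k] B)) :
    res x (G * pull f pX) = res x G * f := by
  ext h
  rw [res_apply, ((ℛ k h).tmul (ℛ k x)).convMul_apply, (ℛ k h).convMul_apply]
  conv_rhs => rw [← sum_smul_counit' (ℛ k x)]
  simp [pull, res_apply, Finset.sum_product, Finset.sum_mul, TensorProduct.tmul_sum]

lemma res_pY (x : H) (f : WithConv (H →ₗ[k] B)) : res x (pull f pY) = cst (f x) := by
  ext h
  simp [pull, res_apply, cst]

lemma res_ext {F G : WithConv (H ⊗[k] H →ₗ[k] B)} (h : ∀ x, res x F = res x G) : F = G := by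
  ext a x
  exact congr(($(h x)).ofConv a)

lemma hM : cg (pM (k := k) (H := H)) = cg pX * cg pY := by
  refine res_ext fun x => ?_
  have : cg (pX (k := k) (H := H)) = pull (toConv LinearMap.id) pX := rfl
  rw [this, res_left]
  have : cg (pY (k := k) (H := H)) = pull (toConv LinearMap.id) pY := rfl
  rw [this, res_pY]
  ext h
  rw [mul_cst_apply]
  rfl


lemma cst_add (a b : B) : (cst (a + b) : WithConv (C →ₗ[k] B)) = cst a + cst b := by
  ext c; simp [cst]

lemma cst_algebraMap (r : k) : (cst (algebraMap k B r) : WithConv (C →ₗ[k] B)) = r • 1 := by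
  ext c
  simp [cst, Algebra.algebraMap_eq_smul_one, smul_smul, mul_comm]

lemma Ph_add (g : C →ₗc[k] H) (a b : B) : Ph β g (a + b) = Ph β g a + Ph β g b := by
  simp only [Ph, cst_add, mul_add, add_mul]

lemma Ph_algebraMap (g : C →ₗc[k] H) (r : k) : Ph β g (algebraMap k B r) = r • EE β g := by
  simp only [Ph, cst_algebraMap, EE, mul_smul_comm, mul_one, smul_mul_assoc]

lemma Ph_one (g : C →ₗc[k] H) : Ph β g 1 = EE β g := by
  simp only [Ph, cst_one, EE, mul_one]

/-- The base subalgebra. -/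
noncomputable def AA (β : H →ₗ[k] B) : Subalgebra k B :=
  Algebra.adjoin k (Set.range (EE β (CoalgHom.id k H)).ofConv)

lemma EE_mem (h : H) : (EE β (CoalgHom.id k H)) h ∈ AA β := Algebra.subset_adjoin ⟨h, rfl⟩

lemma EE_pull (g : C →ₗc[k] H) : EE β g = pull (EE β (CoalgHom.id k H)) g := by rw [pull_EE]; rfl
lemma ET_pull (g : C →ₗc[k] H) : ET β g = pull (ET β (CoalgHom.id k H)) g := by rw [pull_ET]; rfl
lemma Ph_pull (g : C →ₗc[k] H) (a : B) : Ph β g a = pull (Ph β (CoalgHom.id k H) a) g := by rw [pull_Ph]; rfl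
lemma cg_pull (g : C →ₗc[k] H) : bb β (cg g) = pull (bb β (cg (CoalgHom.id k H))) g := rfl
lemma sg_pull (g : C →ₗc[k] H) : bb β (sg g) = pull (bb β (sg (CoalgHom.id k H))) g := rfl

lemma cst_comm_ET_Id (hβ : PRep β) {a : B} (ha : a ∈ AA β) :
    cst a * ET β (CoalgHom.id k H) = ET β (CoalgHom.id k H) * cst a := by
  refine Algebra.adjoin_induction (p := fun a _ => cst a * ET β (CoalgHom.id k H) = ET β (CoalgHom.id k H) * cst a)
    ?_ ?_ ?_ ?_ ha
  · rintro _ ⟨x, rfl⟩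
    have h := congrArg (res x) (EE_ET hβ (hM (k := k) (H := H)))
    rwa [EE_pull (β := β) (pY (k := k) (H := H)), ET_pull (β := β) (pX (k := k) (H := H)), res_right, res_left, res_pY] at h
  · intro r
    rw [cst_algebraMap, smul_mul_assoc, mul_smul_comm, one_mul, mul_one]
  · intro x y _ _ hx hy
    rw [cst_add, add_mul, mul_add, hx, hy]
  · intro x y _ _ hx hy
    rw [cst_mul, mul_assoc, hy, ← mul_assoc, hx, mul_assoc]

lemma cst_comm_ET (hβ : PRep β) {a : B} (ha : a ∈ AA β) (g : C →ₗc[k] H) :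
    cst a * ET β g = ET β g * cst a := by
  have := congrArg (pull · g) (cst_comm_ET_Id hβ ha)
  simpa only [pull_mul, pull_cst, ← ET_pull] using this

lemma Ph_mul (hβ : PRep β) {a : B} (ha : a ∈ AA β) (b : B) (g : C →ₗc[k] H) :
    Ph β g (a * b) = Ph β g a * Ph β g b := by
  symm
  calc Ph β g a * Ph β g b
      = bb β (cg g) * (cst a * ET β g) * cst b * bb β (sg g) := by
        simp only [Ph, ET, mul_assoc]
    _ = (bb β (cg g) * ET β g) * cst a * cst b * bb β (sg g) := by
        rw [cst_comm_ET hβ ha]; simp only [mul_assoc]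
    _ = _ := by rw [csc hβ, Ph, cst_mul]; simp only [mul_assoc]

lemma push_res (hβ : PRep β) (x : H) :
    bb β (cg (CoalgHom.id k H)) * cst ((EE β (CoalgHom.id k H)) x) = res x (EE β pM) * bb β (cg (CoalgHom.id k H)) := by
  have h := congrArg (res x) (push hβ (hM (k := k) (H := H)))
  rwa [cg_pull (β := β) (pX (k := k) (H := H)), EE_pull (β := β) (pY (k := k) (H := H)), res_left, res_pY, res_right] at h

lemma Ph_eps (hβ : PRep β) (x : H) :
    Ph β (CoalgHom.id k H) ((EE β (CoalgHom.id k H)) x) = res x (EE β pM) * EE β (CoalgHom.id k H) := by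
  rw [Ph, push_res hβ, mul_assoc]; rfl

lemma conv_mem {A : Subalgebra k B} {f g : WithConv (C →ₗ[k] B)} (hf : ∀ c, f c ∈ A)
    (hg : ∀ c, g c ∈ A) (c : C) : (f * g).ofConv c ∈ A := by
  rw [(ℛ k c).convMul_apply]
  exact sum_mem fun i _ => mul_mem (hf _) (hg _)

lemma Ph_mem (hβ : PRep β) {a : B} (ha : a ∈ AA β) : ∀ h, (Ph β (CoalgHom.id k H) a) h ∈ AA β := by
  refine Algebra.adjoin_induction (p := fun a _ => ∀ h, (Ph β (CoalgHom.id k H) a) h ∈ AA β) ?_ ?_ ?_ ?_ ha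
  · rintro _ ⟨x, rfl⟩ h
    rw [Ph_eps hβ]
    refine conv_mem (fun c => ?_) (fun c => EE_mem c) h
    rw [EE_pull]
    exact EE_mem (c * x)
  · intro r h
    rw [Ph_algebraMap]
    exact (AA β).smul_mem (EE_mem h) r
  · intro x y _ _ hx hy h
    rw [Ph_add]
    exact add_mem (hx h) (hy h)
  · intro x y hx' _ hx hy h
    rw [Ph_mul hβ hx']
    exact conv_mem hx hy h

lemma pushA (hβ : PRep β) {a : B} (ha : a ∈ AA β) :
    bb β (cg pX) * Ph β pY a = Ph β pM a * bb β (cg pX) := by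
  refine Algebra.adjoin_induction
    (p := fun a _ => bb β (cg pX) * Ph β pY a = Ph β pM a * bb β (cg pX)) ?_ ?_ ?_ ?_ ha
  · rintro _ ⟨y, rfl⟩
    have key : bb β (cg pX) * pull (res y (EE β pM)) pY =
        pull (res y (EE β pM)) pM * bb β (cg pX) := by
      refine res_ext fun x => ?_
      rw [cg_pull (β := β) (pX (k := k) (H := H)), res_left, res_pY, res_right]
      have h := push_res hβ (x * y)
      have h2 : res (x * y) (EE β pM) = res x (pull (res y (EE β pM)) pM) := by
        ext h
        rw [EE_pull (β := β) (pM (k := k) (H := H))]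
        change (EE β (CoalgHom.id k H)) (h * (x * y)) = (EE β (CoalgHom.id k H)) ((h * x) * y)
        rw [mul_assoc]
      rw [← h2, ← h, EE_pull (β := β) (pM (k := k) (H := H))]
      rfl
    rw [Ph_pull (β := β) (pY (k := k) (H := H)), Ph_pull (β := β) (pM (k := k) (H := H)), Ph_eps hβ, pull_mul, pull_mul, ← EE_pull, ← EE_pull,
      ← mul_assoc, key, mul_assoc, push hβ hM, mul_assoc]
  · intro r
    rw [Ph_algebraMap, Ph_algebraMap, mul_smul_comm, smul_mul_assoc, push hβ hM]
  · intro x y _ _ hx hy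
    rw [Ph_add, Ph_add, mul_add, add_mul, hx, hy]
  · intro x y hx' _ hx hy
    rw [Ph_mul hβ hx', Ph_mul hβ hx', ← mul_assoc, hx, mul_assoc, hy, mul_assoc]

lemma res_PhPh (a : B) (x : H) :
    res x (bb β (cg pX) * (Ph β pY a * bb β (sg pX))) = Ph β (CoalgHom.id k H) ((Ph β (CoalgHom.id k H) a) x) := by
  rw [cg_pull (β := β) (pX (k := k) (H := H)), sg_pull (β := β) (pX (k := k) (H := H)), Ph_pull (β := β) (pY (k := k) (H := H)), res_left, res_right, res_pY, ← mul_assoc]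
  rfl

lemma PA4' (hβ : PRep β) {a : B} (ha : a ∈ AA β) (x : H) :
    Ph β (CoalgHom.id k H) ((Ph β (CoalgHom.id k H) a) x) = res x (Ph β pM a) * EE β (CoalgHom.id k H) := by
  rw [← res_PhPh, ← mul_assoc, pushA hβ ha, mul_assoc]
  change res x (Ph β pM a * EE β pX) = _
  rw [EE_pull (β := β) (pX (k := k) (H := H)), res_right]

lemma PA3' (hβ : PRep β) {a : B} (ha : a ∈ AA β) (x : H) :
    Ph β (CoalgHom.id k H) ((Ph β (CoalgHom.id k H) a) x) = EE β (CoalgHom.id k H) * res x (Ph β pM a) := by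
  rw [← res_PhPh, ← res_left, ← EE_pull (β := β) (pX (k := k) (H := H))]
  congr 1
  have hm := hM (k := k) (H := H)
  have e1 : bb β (cg pY) * cst a = Ph β pY a * bb β (cg pY) := by
    calc bb β (cg pY) * cst a = bb β (cg pY) * (ET β pY * cst a) := by
          rw [← mul_assoc, csc hβ]
      _ = _ := by rw [← cst_comm_ET hβ ha]; simp only [Ph, ET, mul_assoc]
  have e2 : Ph β pY a * EE β pY = Ph β pY a := by
    simp only [Ph, EE, mul_assoc]
    rw [← mul_assoc (bb β (sg pY)) (bb β (cg pY))]
    change _ * (_ * (ET β pY * _)) = _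
    rw [scs hβ]
  have e3 : bb β (cg pY) * cst a * bb β (sg pM) = Ph β pY a * bb β (sg pX) := by
    rw [e1, sg_mul hm, mul_assoc, ← P3 hβ, ← mul_assoc]
    change Ph β pY a * EE β pY * _ = _
    rw [e2]
  have e4 : EE β pX * bb β (cg pM) = bb β (cg pX) * bb β (cg pY) := by
    rw [EE, mul_assoc, hm, ← P5 hβ]
    change _ * (ET β pX * _) = _
    rw [← mul_assoc, csc hβ]
  rw [← e3, Ph, ← mul_assoc, ← mul_assoc, ← mul_assoc, ← mul_assoc, e4]

lemma conv_sum (f g : WithConv (H →ₗ[k] B)) (h : H) (n : ℕ) (h1 h2 : Fin n → H)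
    (hh : Coalgebra.comul (R := k) h = ∑ i, h1 i ⊗ₜ[k] h2 i) :
    (f * g).ofConv h = ∑ i, f (h1 i) * g (h2 i) := by
  rw [LinearMap.convMul_apply, hh]
  simp

lemma prep_bracket : PRep (bracket k H) := by
  have conv (u v : H →ₗ[k] TensorAlgebra k H) (x : H) :
      RingQuot.mkAlgHom k (HparRel k H) (sw k H u v x) =
      (toConv ((RingQuot.mkAlgHom k (HparRel k H)).toLinearMap ∘ₗ u) *
        toConv ((RingQuot.mkAlgHom k (HparRel k H)).toLinearMap ∘ₗ v)).ofConv x := by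
    exact congr($(LinearMap.algHom_comp_convMul_distrib (RingQuot.mkAlgHom k (HparRel k H))
      (toConv u) (toConv v)) x)
  constructor
  · exact (RingQuot.mkAlgHom_rel k (HparRel.one (k := k) (H := H))).trans (map_one _)
  · intro h x
    have := RingQuot.mkAlgHom_rel k (HparRel.pr2 (k := k) (H := H) h x)
    rw [map_mul, conv, conv] at this
    exact this
  · intro h x
    have := RingQuot.mkAlgHom_rel k (HparRel.pr3 (k := k) (H := H) h x)
    rw [map_mul, conv, conv] at this
    exact this
  · intro h x
    have := RingQuot.mkAlgHom_rel k (HparRel.pr4 (k := k) (H := H) h x)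
    rw [map_mul, conv, conv] at this
    exact this
  · intro h x
    have := RingQuot.mkAlgHom_rel k (HparRel.pr5 (k := k) (H := H) h x)
    rw [map_mul, conv, conv] at this
    exact this

lemma hact_eq (h : H) (a : Hpar k H) : hact k H h a = (Ph (bracket k H) (CoalgHom.id k H) a) h := by
  have : cst a * bb (bracket k H) (sg (CoalgHom.id k H)) =
      toConv ((LinearMap.mulLeft k a) ∘ₗ (bracket k H) ∘ₗ antipode (R := k)) := by
    ext h
    rw [cst_mul_apply]
    rfl
  rw [Ph, mul_assoc, this]
  rfl

lemma adjoin_eq : Algebra.adjoin k (Set.range (epsilonPar k H)) = AA (bracket k H) := rfl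

end Aux

/-- The formula `h·a = [h₍₁₎] a [S(h₍₂₎)]` defines a symmetric partial
action of `H` on the subalgebra `A ⊆ H_par` generated by the elements
`ε_h = [h₍₁₎][S(h₍₂₎)]`: it preserves `A`, `1_H·a = a`,
`h·(ab) = (h₍₁₎·a)(h₍₂₎·b)`, and
`h·(x·a) = (h₍₁₎·1)(h₍₂₎x·a) = (h₍₁₎x·a)(h₍₂₎·1)`. -/
theorem Hpar_base_algebra_partial_action :
    -- h·a lies in A for a ∈ A
    (∀ (h : H) (a : Hpar k H), a ∈ Algebra.adjoin k (Set.range (epsilonPar k H)) →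
      hact k H h a ∈ Algebra.adjoin k (Set.range (epsilonPar k H))) ∧
    -- (PA1)
    (∀ a ∈ Algebra.adjoin k (Set.range (epsilonPar k H)), hact k H 1 a = a) ∧
    -- (PA2)
    (∀ (h : H), ∀ a ∈ Algebra.adjoin k (Set.range (epsilonPar k H)),
      ∀ b ∈ Algebra.adjoin k (Set.range (epsilonPar k H)),
      ∀ (n : ℕ) (h1 h2 : Fin n → H),
      Coalgebra.comul (R := k) h = ∑ i, h1 i ⊗ₜ[k] h2 i →
      hact k H h (a * b) = ∑ i, hact k H (h1 i) a * hact k H (h2 i) b) ∧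
    -- (PA3)
    (∀ (h x : H), ∀ a ∈ Algebra.adjoin k (Set.range (epsilonPar k H)),
      ∀ (n : ℕ) (h1 h2 : Fin n → H),
      Coalgebra.comul (R := k) h = ∑ i, h1 i ⊗ₜ[k] h2 i →
      hact k H h (hact k H x a) = ∑ i, hact k H (h1 i) 1 * hact k H (h2 i * x) a) ∧
    -- (PA4)
    (∀ (h x : H), ∀ a ∈ Algebra.adjoin k (Set.range (epsilonPar k H)),
      ∀ (n : ℕ) (h1 h2 : Fin n → H),
      Coalgebra.comul (R := k) h = ∑ i, h1 i ⊗ₜ[k] h2 i →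
      hact k H h (hact k H x a) = ∑ i, hact k H (h1 i * x) a * hact k H (h2 i) 1) := by
  rw [adjoin_eq]
  have hβ := prep_bracket (k := k) (H := H)
  simp only [hact_eq]
  refine ⟨fun h a ha => Ph_mem hβ ha h, fun a ha => ?_, fun h a ha b hb n h1 h2 hh => ?_,
    fun h x a ha n h1 h2 hh => ?_, fun h x a ha n h1 h2 hh => ?_⟩
  · rw [← hact_eq]
    simp [hact, Bialgebra.comul_one, Algebra.TensorProduct.one_def, hβ.one]
  · rw [Ph_mul hβ ha, conv_sum _ _ h n h1 h2 hh]
  · rw [PA3' hβ ha, conv_sum _ _ h n h1 h2 hh]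
    simp only [Ph_one, Ph_pull (β := bracket k H) (pM (k := k) (H := H))]
    rfl
  · rw [PA4' hβ ha, conv_sum _ _ h n h1 h2 hh]
    simp only [Ph_one, Ph_pull (β := bracket k H) (pM (k := k) (H := H))]
    rfl
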